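/- Let μ_n and ν_n be sequences of Borel probability measures on a Polish space such that the family {ν_n} is tight and μ_n − ν_n converges weakly to the zero measure (∫ f dμ_n − ∫ f dν_n → 0 for all bounded continuous f). Then the family {μ_n} is tight. -/

import Mathlib

open MeasureTheory ProbabilityTheory Filter Topology BoundedContinuousFunction

/-- A family of measures indexed by `ℕ` is tight: for every `ε > 0` there is one compact set
`K` with `μ_n(K) ≥ 1 − ε` for all `n`. -/
def TightFamily {α : Type*} [TopologicalSpace α] [MeasurableSpace α]
    (μ : ℕ → MeasureTheory.Measure α) : Prop :=
  ∀ ε : ℝ, 0 < ε → ∃ K : Set α, IsCompact K ∧ ∀ n, ENNReal.ofReal (1 - ε) ≤ μ n K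

open Metric in
/-- In a complete metric space, a set of measures is tight as soon as every closed thickening
radius admits a compact set whose thickening carries almost all the mass, uniformly. -/
theorem isTightMeasureSet_of_forall_exists_isCompact_cthickening
    {α : Type*} [MetricSpace α] [CompleteSpace α] [MeasurableSpace α] {S : Set (Measure α)}
    (h : ∀ ε : ENNReal, 0 < ε → ∀ δ : ℝ, 0 < δ →
      ∃ K : Set α, IsCompact K ∧ ∀ μ ∈ S, μ (cthickening δ K)ᶜ ≤ ε) :
    IsTightMeasureSet S := by
  rw [isTightMeasureSet_iff_exists_isCompact_measure_compl_le]
  intro ε hε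
  obtain ⟨η, hη_pos, hη_sum⟩ := ENNReal.exists_pos_sum_of_countable' hε.ne' ℕ
  have hδ_pos (m : ℕ) : (0 : ℝ) < 1 / (m + 1) := by positivity
  choose K hK hKS using fun m : ℕ ↦ h (η m) (hη_pos m) (1 / (m + 1)) (hδ_pos m)
  refine ⟨⋂ m : ℕ, cthickening (1 / (m + 1)) (K m), ?_, fun μ hμ ↦ ?_⟩
  · refine TotallyBounded.isCompact_of_isClosed (totallyBounded_iff.2 fun r hr ↦ ?_)
      (isClosed_iInter fun _ ↦ isClosed_cthickening)
    obtain ⟨m, hm⟩ := exists_nat_one_div_lt (half_pos hr)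
    obtain ⟨t, ht, htK⟩ := totallyBounded_iff.1 (hK m).totallyBounded (r / 2) (half_pos hr)
    refine ⟨t, ht, fun x hx ↦ ?_⟩
    have hxm := Set.mem_iInter.1 hx m
    rw [(hK m).cthickening_eq_biUnion_closedBall (hδ_pos m).le] at hxm
    obtain ⟨y, hy, hxy⟩ := Set.mem_iUnion₂.1 hxm
    obtain ⟨z, hz, hyz⟩ := Set.mem_iUnion₂.1 (htK hy)
    refine Set.mem_iUnion₂.2 ⟨z, hz, ?_⟩
    rw [mem_closedBall] at hxy
    rw [mem_ball] at hyz ⊢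
    linarith [dist_triangle x y z]
  · rw [Set.compl_iInter]
    exact (measure_iUnion_le _).trans ((ENNReal.tsum_le_tsum fun m ↦ hKS m μ hμ).trans hη_sum.le)

/-- A finite set of finite measures on a Polish space is tight. -/
theorem isTightMeasureSet_of_finite
    {α : Type*} [TopologicalSpace α] [PolishSpace α] [MeasurableSpace α] [BorelSpace α]
    {S : Set (Measure α)} (hS : S.Finite) (hfin : ∀ μ ∈ S, IsFiniteMeasure μ) :
    IsTightMeasureSet S := by
  induction S, hS using Set.Finite.induction_on with
  | empty =>
    exact isTightMeasureSet_iff_exists_isCompact_measure_compl_le.2 fun _ _ ↦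
      ⟨∅, isCompact_empty, by simp⟩
  | @insert μ T _ _ ih =>
    have := hfin μ (Set.mem_insert μ T)
    rw [Set.insert_eq]
    exact isTightMeasureSet_singleton.union (ih fun ν hν ↦ hfin ν (Set.mem_insert_of_mem μ hν))

/-- For probability measures on a Hausdorff space, `TightFamily` agrees with Mathlib's notion of
tightness of the range. -/
theorem tightFamily_iff_isTightMeasureSet_range
    {α : Type*} [TopologicalSpace α] [T2Space α] [MeasurableSpace α] [OpensMeasurableSpace α]
    {μ : ℕ → Measure α} [∀ n, IsProbabilityMeasure (μ n)] :
    TightFamily μ ↔ IsTightMeasureSet (Set.range μ) := by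
  simp only [isTightMeasureSet_iff_exists_isCompact_measure_compl_le, Set.forall_mem_range]
  have key {K : Set α} (hK : IsCompact K) {ε : ℝ} (hε : 0 < ε) (n : ℕ) :
      ENNReal.ofReal (1 - ε) ≤ μ n K ↔ μ n Kᶜ ≤ ENNReal.ofReal ε := by
    rw [← ofReal_measureReal, ← ofReal_measureReal, probReal_compl_eq_one_sub hK.measurableSet,
      ENNReal.ofReal_le_ofReal_iff measureReal_nonneg, ENNReal.ofReal_le_ofReal_iff hε.le,
      sub_le_comm]
  refine ⟨fun h ε hε ↦ ?_, fun h ε hε ↦ ?_⟩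
  · obtain ⟨r, -, hr_pos, hrε⟩ := ENNReal.lt_iff_exists_real_btwn.1 hε
    have hr : 0 < r := ENNReal.ofReal_pos.1 hr_pos
    obtain ⟨K, hK, hKμ⟩ := h r hr
    exact ⟨K, hK, fun n ↦ ((key hK hr n).1 (hKμ n)).trans hrε.le⟩
  · obtain ⟨K, hK, hKμ⟩ := h (ENNReal.ofReal ε) (ENNReal.ofReal_pos.2 hε)
    exact ⟨K, hK, fun n ↦ (key hK hε n).2 (hKμ n)⟩

open Metric in
/-- If integrals of bounded continuous functions against `μ n` and `ν n` are asymptotically equal,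
then eventually `μ n` gives to a thickening of a closed set almost as much mass as `ν n` gives to
the set itself. -/
theorem eventually_measureReal_le_measureReal_cthickening_add
    {α : Type*} [PseudoMetricSpace α] [MeasurableSpace α] [OpensMeasurableSpace α]
    {μ ν : ℕ → Measure α} [∀ n, IsFiniteMeasure (μ n)] [∀ n, IsFiniteMeasure (ν n)]
    (hdiff : ∀ f : α →ᵇ ℝ,
      Tendsto (fun n ↦ (∫ x, f x ∂(μ n)) - (∫ x, f x ∂(ν n))) atTop (𝓝 0))
    {F : Set α} (hF : IsClosed F) {δ ε : ℝ} (hδ : 0 < δ) (hε : 0 < ε) :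
    ∀ᶠ n in atTop, (ν n).real F ≤ (μ n).real (cthickening δ F) + ε := by
  let f : α →ᵇ ℝ := BoundedContinuousFunction.ofNormedAddCommGroup
    (fun x ↦ (thickenedIndicator hδ F x : ℝ)) (by fun_prop) 1
    fun x ↦ by simpa using thickenedIndicator_le_one hδ F x
  have hf_apply (x : α) : f x = thickenedIndicator hδ F x := rfl
  have hf_lower (x : α) : F.indicator 1 x ≤ f x := by
    by_cases hx : x ∈ F
    · rw [hf_apply, thickenedIndicator_one hδ F hx]
      simp [hx]
    · simp [f, hx]
  have hf_upper (x : α) : f x ≤ (cthickening δ F).indicator 1 x := by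
    by_cases hx : x ∈ cthickening δ F
    · simpa [f, hx] using thickenedIndicator_le_one hδ F x
    · rw [hf_apply, thickenedIndicator_zero hδ F fun h ↦ hx (thickening_subset_cthickening δ F h)]
      simp [hx]
  filter_upwards [(hdiff f).eventually_const_lt (neg_lt_zero.2 hε)] with n hn
  have hν : (ν n).real F ≤ ∫ x, f x ∂(ν n) := by
    rw [← integral_indicator_one hF.measurableSet]
    exact integral_mono ((integrable_const 1).indicator hF.measurableSet) (f.integrable _) hf_lower
  have hμ : ∫ x, f x ∂(μ n) ≤ (μ n).real (cthickening δ F) := by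
    rw [← integral_indicator_one isClosed_cthickening.measurableSet]
    exact integral_mono (f.integrable _)
      ((integrable_const 1).indicator isClosed_cthickening.measurableSet) hf_upper
  linarith

/-- If `{ν_n}` is a tight family of Borel probability measures on a Polish space and
`μ_n − ν_n` converges weakly to the zero measure, then `{μ_n}` is tight as well. -/
theorem tightness_transfer
    {α : Type*} [TopologicalSpace α] [PolishSpace α] [MeasurableSpace α] [BorelSpace α]
    (μ ν : ℕ → Measure α)
    [∀ n, IsProbabilityMeasure (μ n)] [∀ n, IsProbabilityMeasure (ν n)]
    (hνtight : TightFamily ν)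
    (hdiff : ∀ f : α →ᵇ ℝ,
      Tendsto (fun n => (∫ x, f x ∂(μ n)) - (∫ x, f x ∂(ν n))) atTop (𝓝 0)) :
    TightFamily μ := by
  let _ := TopologicalSpace.upgradeIsCompletelyMetrizable α
  rw [tightFamily_iff_isTightMeasureSet_range]
  refine isTightMeasureSet_of_forall_exists_isCompact_cthickening fun ε hε δ hδ ↦ ?_
  obtain ⟨r, -, hr_pos, hrε⟩ := ENNReal.lt_iff_exists_real_btwn.1 hε
  have hr : 0 < r := ENNReal.ofReal_pos.1 hr_pos
  obtain ⟨K, hK, hKν⟩ := hνtight (r / 2) (half_pos hr)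
  obtain ⟨N, hN⟩ := eventually_atTop.1 <|
    eventually_measureReal_le_measureReal_cthickening_add hdiff hK.isClosed hδ (half_pos hr)
  have hfin : IsTightMeasureSet (μ '' Set.Iio N) :=
    isTightMeasureSet_of_finite ((Set.finite_Iio N).image μ) <| by
      rintro _ ⟨n, -, rfl⟩
      infer_instance
  obtain ⟨L, hL, hLμ⟩ := isTightMeasureSet_iff_exists_isCompact_measure_compl_le.1 hfin ε hε
  refine ⟨K ∪ L, hK.union hL, ?_⟩
  rintro _ ⟨n, rfl⟩
  rcases lt_or_ge n N with hn | hn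
  · refine le_trans (measure_mono ?_) (hLμ _ (Set.mem_image_of_mem μ hn))
    exact Set.compl_subset_compl.2
      (Set.subset_union_right.trans (Metric.self_subset_cthickening _))
  · have hν : 1 - r / 2 ≤ (ν n).real K :=
      (ENNReal.ofReal_le_iff_le_toReal (measure_ne_top _ _)).1 (hKν n)
    calc μ n (Metric.cthickening δ (K ∪ L))ᶜ
        ≤ μ n (Metric.cthickening δ K)ᶜ := measure_mono <| Set.compl_subset_compl.2 <|
          Metric.cthickening_subset_of_subset δ Set.subset_union_left
      _ ≤ ENNReal.ofReal r := by
        rw [← ofReal_measureReal,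
          probReal_compl_eq_one_sub Metric.isClosed_cthickening.measurableSet]
        exact ENNReal.ofReal_le_ofReal (by linarith [hN n hn])
      _ ≤ ε := hrε.le
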